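/- arXiv:1105.3293 — 3 statements merged into one kernel-verified Lean document; each statement's English description precedes it below -/
import Mathlib

section
/- Let $K$ be a field, $V$ a $K$-vector space with $\mathrm{finrank}_K V = d \geq 1$, and $(p_i)_{i \in \iota}$ a family of vectors indexed by a finite set $\iota$ with $|\iota| = d + 1$, such that every $d$-element subfamily is linearly independent. Then for all subsets $I, J \subseteq \iota$ with $I \cup J \neq \iota$, one has $\mathrm{span}_K\{p_i : i \in I\} \cap \mathrm{span}_K\{p_i : i \in J\} = \mathrm{span}_K\{p_i : i \in I \cap J\}$. -/
open Module

/-- If `v` is linearly independent on `u`, spans of subfamilies indexed by subsets of `u` intersect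
in the span of the common subfamily. -/
theorem LinearIndepOn.span_image_inf_span_image {R M ι : Type*} [Ring R] [AddCommGroup M]
    [Module R M] {v : ι → M} {u s t : Set ι} (hv : LinearIndepOn R v u) (hs : s ⊆ u) (ht : t ⊆ u) :
    Submodule.span R (v '' s) ⊓ Submodule.span R (v '' t) = Submodule.span R (v '' (s ∩ t)) := by
  refine le_antisymm ?_ (le_inf (Submodule.span_mono (Set.image_mono Set.inter_subset_left))
    (Submodule.span_mono (Set.image_mono Set.inter_subset_right)))
  rintro x ⟨hxs, hxt⟩
  obtain ⟨f, hf, rfl⟩ := (Finsupp.mem_span_image_iff_linearCombination R).1 hxs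
  obtain ⟨g, hg, hgf⟩ := (Finsupp.mem_span_image_iff_linearCombination R).1 hxt
  have hfg : g = f := linearIndepOn_iffₛ.1 hv g (Finsupp.supported_mono ht hg) f
    (Finsupp.supported_mono hs hf) hgf
  subst hfg
  exact (Finsupp.mem_span_image_iff_linearCombination R).2
    ⟨g, by rw [Finsupp.supported_inter]; exact ⟨hf, hg⟩, rfl⟩

/-- For `d+1` points in general position in a `d`-dimensional space, the spans
of the points labeled by `I` and by `J` intersect in the span of the points
labeled by `I ∩ J`, provided `I ∪ J` is not the whole index set. -/
theorem span_inter_span_of_general_position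
    (K V ι : Type*) [Field K] [AddCommGroup V] [Module K V]
    [Fintype ι] [DecidableEq ι]
    (d : ℕ) (hd : 1 ≤ d) (hV : finrank K V = d) (hι : Fintype.card ι = d + 1)
    (p : ι → V)
    (hgen : ∀ J : Finset ι, J.card = d → LinearIndependent K (fun i : J => p i.1)) :
    ∀ I J : Finset ι, I ∪ J ≠ Finset.univ →
      Submodule.span K (p '' (I : Set ι)) ⊓ Submodule.span K (p '' (J : Set ι)) =
        Submodule.span K (p '' ((I ∩ J : Finset ι) : Set ι)) := by
  intro I J hIJ
  obtain ⟨a, ha⟩ : ∃ a, a ∉ I ∪ J := by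
    by_contra! h
    exact hIJ (Finset.eq_univ_iff_forall.2 h)
  have hli : LinearIndepOn K p ((Finset.univ.erase a : Finset ι) : Set ι) :=
    hgen _ (by simp [Finset.card_erase_of_mem, hι])
  have hsub : ∀ {s : Finset ι}, s ⊆ I ∪ J → (s : Set ι) ⊆ (Finset.univ.erase a : Finset ι) :=
    fun hs => Finset.coe_subset.2 (Finset.subset_erase.2
      ⟨Finset.subset_univ _, fun h => ha (hs h)⟩)
  rw [Finset.coe_inter]
  exact hli.span_image_inf_span_image (hsub Finset.subset_union_left)
    (hsub Finset.subset_union_right)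
end

section
/- Let $K$ be a field, $V$ a $K$-vector space with $\mathrm{finrank}_K V = d \geq 1$, and $(p_i)_{i \in \iota}$ a family of vectors indexed by a finite set $\iota$ with $|\iota| = d + 1$, such that every $d$-element subfamily is linearly independent. Then for all subsets $I, J \subsetneq \iota$ (both proper) with $I \cup J = \iota$, one has $\mathrm{finrank}_K\big(\mathrm{span}_K\{p_i : i \in I\} \cap \mathrm{span}_K\{p_i : i \in J\}\big) = |I \cap J| + 1$. -/
open Module

section GeneralPosition

variable {K V ι : Type*} [Field K] [AddCommGroup V] [Module K V]

theorem finrank_span_image_of_linearIndepOn {p : ι → V} {s : Finset ι}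
    (h : LinearIndepOn K p (s : Set ι)) :
    finrank K (Submodule.span K (p '' (s : Set ι))) = s.card := by
  have h' : LinearIndependent K (fun i : s => p i) := h
  rw [Set.image_eq_range]
  exact (finrank_span_eq_card h').trans (Fintype.card_coe s)

theorem linearIndepOn_of_forall_card_eq [Fintype ι] {d : ℕ} {p : ι → V}
    (hι : d ≤ Fintype.card ι)
    (hgen : ∀ s : Finset ι, s.card = d → LinearIndepOn K p (s : Set ι))
    {s : Finset ι} (hs : s.card ≤ d) : LinearIndepOn K p (s : Set ι) := by
  obtain ⟨t, hst, ht⟩ := Finset.exists_superset_card_eq hs hι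
  exact (hgen t ht).mono (Finset.coe_subset.2 hst)

end GeneralPosition

/-- For `d+1` points in general position in a `d`-dimensional space, if `I` and
`J` are proper subsets of the index set covering it, then the spans of the
points labeled by `I` and by `J` meet in dimension `|I ∩ J| + 1`. -/
theorem finrank_span_inter_span_of_cover
    (K V ι : Type*) [Field K] [AddCommGroup V] [Module K V]
    [Fintype ι] [DecidableEq ι]
    (d : ℕ) (hd : 1 ≤ d) (hV : finrank K V = d) (hι : Fintype.card ι = d + 1)
    (p : ι → V)
    (hgen : ∀ J : Finset ι, J.card = d → LinearIndependent K (fun i : J => p i.1)) :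
    ∀ I J : Finset ι, I ≠ Finset.univ → J ≠ Finset.univ → I ∪ J = Finset.univ →
      finrank K ↥(Submodule.span K (p '' (I : Set ι)) ⊓
          Submodule.span K (p '' (J : Set ι))) = (I ∩ J).card + 1 := by
  intro I J hI hJ hIJ
  have : FiniteDimensional K V := FiniteDimensional.of_finrank_pos (by omega)
  have finrank_span : ∀ s : Finset ι, s.card ≤ d →
      finrank K (Submodule.span K (p '' (s : Set ι))) = s.card := fun s hs =>
    finrank_span_image_of_linearIndepOn
      (linearIndepOn_of_forall_card_eq (by omega) hgen hs)
  have hId : I.card < Fintype.card ι := (Finset.card_lt_iff_ne_univ I).2 hI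
  have hJd : J.card < Fintype.card ι := (Finset.card_lt_iff_ne_univ J).2 hJ
  obtain ⟨s, -, hs⟩ := Finset.exists_superset_card_eq (s := I) (n := d) (by omega) (by omega)
  have hsup : finrank K ↥(Submodule.span K (p '' (I : Set ι)) ⊔
      Submodule.span K (p '' (J : Set ι))) = d := by
    rw [← Submodule.span_union, ← Set.image_union, ← Finset.coe_union, hIJ]
    refine le_antisymm (hV ▸ Submodule.finrank_le _) ?_
    calc d = finrank K (Submodule.span K (p '' (s : Set ι))) := by rw [finrank_span s hs.le, hs]
      _ ≤ _ := Submodule.finrank_mono (Submodule.span_mono (Set.image_mono (by simp)))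
  have hdim := Submodule.finrank_sup_add_finrank_inf_eq
    (Submodule.span K (p '' (I : Set ι))) (Submodule.span K (p '' (J : Set ι)))
  rw [hsup, finrank_span I (by omega), finrank_span J (by omega)] at hdim
  have hcard := Finset.card_union_add_card_inter I J
  rw [hIJ, Finset.card_univ] at hcard
  omega
end

section
/- Let $K$ be a field, $V$ a $K$-vector space with $\mathrm{finrank}_K V = d \geq 1$, and $(p_i)_{i \in \iota}$ a family of vectors indexed by a finite set $\iota$ with $|\iota| = d + 1$, such that every $d$-element subfamily is linearly independent. Let $I_1, \ldots, I_k$ (with $k \geq 1$) be subsets of $\iota$ with $|\bigcup_{j=1}^k I_j| \leq d$, and set $U_j = \mathrm{span}_K\{p_i : i \in I_j\}$. Then the canonical linear map $V \to \prod_{j=1}^k V/U_j$, sending $v$ to $(v + U_j)_j$, is surjective if and only if $d - |\bigcap_{j=1}^k I_j| = \sum_{j=1}^k (d - |I_j|)$. -/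
open Module

/-- Spans of subfamilies of a basis: intersecting the spans amounts to intersecting the index
sets. -/
theorem Module.Basis.iInf_span_image {K V κ α : Type*} [Semiring K] [AddCommMonoid V] [Module K V]
    (b : Basis κ K V) (s : α → Set κ) :
    ⨅ a, Submodule.span K (b '' s a) = Submodule.span K (b '' ⋂ a, s a) := by
  ext x
  simp only [Submodule.mem_iInf, Basis.mem_span_image, Set.subset_iInter_iff]

/-- In a finite-dimensional space, the canonical map to a finite product of quotients is surjective
iff the codimension of the intersection is the sum of the codimensions. -/
theorem Submodule.surjective_pi_mkQ_iff_finrank {K V α : Type*} [DivisionRing K] [AddCommGroup V]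
    [Module K V] [FiniteDimensional K V] [Fintype α] (U : α → Submodule K V) :
    Function.Surjective (LinearMap.pi (fun a => (U a).mkQ) : V →ₗ[K] Π a, V ⧸ U a) ↔
      finrank K V - finrank K (⨅ a, U a : Submodule K V) =
        ∑ a, (finrank K V - finrank K (U a)) := by
  have hker : LinearMap.ker (LinearMap.pi (fun a => (U a).mkQ) : V →ₗ[K] Π a, V ⧸ U a) =
      ⨅ a, U a := by
    simp [LinearMap.ker_pi]
  have hrank := LinearMap.finrank_range_add_finrank_ker
    (LinearMap.pi (fun a => (U a).mkQ) : V →ₗ[K] Π a, V ⧸ U a)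
  have hcod : finrank K (Π a, V ⧸ U a) = ∑ a, (finrank K V - finrank K (U a)) := by
    rw [finrank_pi_fintype]
    exact Finset.sum_congr rfl fun a _ => (U a).finrank_quotient
  rw [hker] at hrank
  rw [← hcod, ← hrank, Nat.add_sub_cancel, ← LinearMap.range_eq_top]
  exact ⟨fun h => by rw [h, finrank_top], Submodule.eq_top_of_finrank_eq⟩

/-- Linear-algebra heart of the Castravet–Tevelev criterion: for spans of
subsets of `d+1` points in general position in a `d`-dimensional space, with
the union of the labeling sets of size at most `d`, the canonical map to the
product of quotients is surjective iff the codimensions add up exactly. -/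
theorem surjective_pi_mkQ_span_iff_of_general_position
    (K V ι : Type*) [Field K] [AddCommGroup V] [Module K V]
    [Fintype ι] [DecidableEq ι]
    (d : ℕ) (hd : 1 ≤ d) (hV : finrank K V = d) (hι : Fintype.card ι = d + 1)
    (p : ι → V)
    (hgen : ∀ J : Finset ι, J.card = d → LinearIndependent K (fun i : J => p i.1))
    (k : ℕ) (hk : 1 ≤ k) (I : Fin k → Finset ι)
    (hunion : (Finset.univ.biUnion I).card ≤ d)
    (U : Fin k → Submodule K V)
    (hU : ∀ j, U j = Submodule.span K (p '' ((I j : Finset ι) : Set ι))) :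
    Function.Surjective
        (LinearMap.pi (fun j => (U j).mkQ) : V →ₗ[K] Π j, V ⧸ U j) ↔
      d - (Finset.univ.inf I).card = ∑ j, (d - (I j).card) := by
  have : FiniteDimensional K V := FiniteDimensional.of_finrank_pos (by omega)
  obtain ⟨J, hIJ, -, hJ⟩ := Finset.exists_subsuperset_card_eq
    (Finset.subset_univ (Finset.univ.biUnion I)) hunion (by rw [Finset.card_univ]; omega)
  have hsub (j : Fin k) : I j ⊆ J := (Finset.subset_biUnion_of_mem I (Finset.mem_univ j)).trans hIJ
  have : Nonempty J := (Finset.card_pos.mp (by omega)).to_subtype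
  have hli := hgen J hJ
  let b : Basis J K V := basisOfLinearIndependentOfCardEqFinrank hli (by simp [hJ, hV])
  have himage (S : Finset ι) (hS : S ⊆ J) : b '' (Subtype.val ⁻¹' (S : Set ι)) = p '' S := by
    rw [show (b : J → V) = p ∘ Subtype.val by simp [b]; rfl, Set.image_comp,
      Set.image_preimage_eq_of_subset (by simpa using hS)]
  have hcard (S : Finset ι) (hS : S ⊆ J) : finrank K (Submodule.span K (p '' S)) = S.card := by
    have h : LinearIndepOn K p (S : Set ι) :=
      LinearIndepOn.mono (s := (J : Set ι)) hli (Finset.coe_subset.mpr hS)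
    rw [Set.image_eq_range, finrank_span_eq_card h]
    simp
  have hinf : ⨅ j, U j = Submodule.span K (p '' (Finset.univ.inf I : Finset ι)) := by
    rw [← himage _ ((Finset.inf_le (Finset.mem_univ ⟨0, hk⟩)).trans (hsub ⟨0, hk⟩))]
    have hUb (j : Fin k) : U j = Submodule.span K (b '' (Subtype.val ⁻¹' (I j : Set ι))) := by
      rw [hU, himage _ (hsub j)]
    simp_rw [hUb, b.iInf_span_image]
    congr 2
    ext x
    simp [Finset.mem_inf]
  rw [Submodule.surjective_pi_mkQ_iff_finrank, hinf, hV,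
    hcard _ ((Finset.inf_le (Finset.mem_univ ⟨0, hk⟩)).trans (hsub ⟨0, hk⟩))]
  have hUcard (j : Fin k) : finrank K (U j) = (I j).card := by rw [hU, hcard _ (hsub j)]
  simp_rw [hUcard]
end
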